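/- Let n ≥ 2, let r : Fin n → ℕ be a family of independent geometric random variables with P(r(j) = m) = 1/2^{m+1}, and let T(r) be the (unique) zip tree on nodes with keys 0, …, n−1 and ranks r. Then for every index i, the expected number of descendants of node i in T(r), including node i itself, is at most (3/2)·lg n + 3. -/

import Mathlib

open scoped ENNReal

/-- A binary tree whose nodes carry a key of type `α` and a natural-number rank. -/
inductive ZTree (α : Type) : Type where
  | leaf : ZTree α
  | node (left : ZTree α) (key : α) (rank : ℕ) (right : ZTree α) : ZTree α

namespace ZTree
variable {α : Type} [LinearOrder α]

/-- The list of (key, rank) pairs of the nodes of the tree, in symmetric order. -/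
def nodes : ZTree α → List (α × ℕ)
  | .leaf => []
  | .node l k rk r => l.nodes ++ (k, rk) :: r.nodes

/-- Binary-search-tree (symmetric order) property. -/
def isBST : ZTree α → Prop
  | .leaf => True
  | .node l k _ r =>
      (∀ p ∈ l.nodes, p.1 < k) ∧ (∀ p ∈ r.nodes, k < p.1) ∧ l.isBST ∧ r.isBST

/-- The rank of the root node, if any. -/
def rootRank? : ZTree α → Option ℕ
  | .leaf => none
  | .node _ _ rk _ => some rk

/-- Max-heap order on ranks, ties broken in favor of smaller keys: every node's rank is
strictly greater than that of its left child and at least that of its right child. -/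
def isRankHeap : ZTree α → Prop
  | .leaf => True
  | .node l _ rk r =>
      (∀ m ∈ l.rootRank?, m < rk) ∧ (∀ m ∈ r.rootRank?, m ≤ rk) ∧
        l.isRankHeap ∧ r.isRankHeap

/-- The zip-tree conditions: symmetric order on keys and heap order on ranks. -/
def isZipTree (t : ZTree α) : Prop := t.isBST ∧ t.isRankHeap

/-- The (key, rank) pairs on the search path from the root to the node with key `a`. -/
def pathTo (a : α) : ZTree α → List (α × ℕ)
  | .leaf => []
  | .node l k rk r =>
      if a < k then (k, rk) :: l.pathTo a
      else if k < a then (k, rk) :: r.pathTo a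
      else [(k, rk)]

/-- The depth (number of edges from the root) of the node with key `a`. -/
def depth (a : α) : ZTree α → ℕ
  | .leaf => 0
  | .node l k _ r =>
      if a < k then l.depth a + 1
      else if k < a then r.depth a + 1
      else 0

/-- The subtree rooted at the node with key `a`. -/
def subtreeAt (a : α) : ZTree α → ZTree α
  | .leaf => .leaf
  | .node l k rk r =>
      if a < k then l.subtreeAt a
      else if k < a then r.subtreeAt a
      else .node l k rk r

/-- Number of nodes on the left spine (root through left children). -/
def leftSpineLen : ZTree α → ℕ
  | .leaf => 0
  | .node l _ _ _ => l.leftSpineLen + 1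

/-- Number of nodes on the right spine (root through right children). -/
def rightSpineLen : ZTree α → ℕ
  | .leaf => 0
  | .node _ _ _ r => r.rightSpineLen + 1

/-- Total number of nodes on the right spine of the left subtree of the node with key `a`
together with the left spine of its right subtree: the paths zipped when deleting this
node, equivalently, the path unzipped when inserting it. -/
def zipSpineCount (a : α) (t : ZTree α) : ℕ :=
  match t.subtreeAt a with
  | .leaf => 0
  | .node l _ _ r => l.rightSpineLen + r.leftSpineLen

end ZTree

namespace ZTree

/-- In a rank heap every node has rank at most the root rank. -/
theorem isRankHeap.rank_le_of_mem_nodes {α : Type} {t : ZTree α} (h : t.isRankHeap) {m : ℕ}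
    (hm : m ∈ t.rootRank?) {q : α × ℕ} (hq : q ∈ t.nodes) : q.2 ≤ m := by
  induction t generalizing m with
  | leaf => simp [nodes] at hq
  | node l k rk r ihl ihr =>
    obtain rfl : rk = m := by simpa [rootRank?] using hm
    obtain ⟨hl, hr, hhl, hhr⟩ := h
    simp only [nodes, List.mem_append, List.mem_cons] at hq
    rcases hq with hq | rfl | hq
    · cases l with
      | leaf => simp [nodes] at hq
      | node a b c d => exact (ihl hhl rfl hq).trans (hl c rfl).le
    · rfl
    · cases r with
      | leaf => simp [nodes] at hq
      | node a b c d => exact (ihr hhr rfl hq).trans (hr c rfl)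

theorem isRankHeap.rank_lt_of_mem_left {α : Type} {l r : ZTree α} {k : α} {rk : ℕ}
    (h : (node l k rk r).isRankHeap) {q : α × ℕ} (hq : q ∈ l.nodes) : q.2 < rk := by
  obtain ⟨hl, -, hhl, -⟩ := h
  cases l with
  | leaf => simp [nodes] at hq
  | node a b c d => exact (hhl.rank_le_of_mem_nodes rfl hq).trans_lt (hl c rfl)

theorem subtreeAt_nodes_sublist {α : Type} [LinearOrder α] (a : α) (t : ZTree α) :
    (t.subtreeAt a).nodes.Sublist t.nodes := by
  induction t with
  | leaf => simp [subtreeAt]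
  | node l k rk r ihl ihr =>
    simp only [subtreeAt]
    split_ifs
    · exact ihl.trans (List.sublist_append_left _ _)
    · exact (ihr.trans (List.sublist_cons_self _ _)).trans (List.sublist_append_right _ _)
    · rfl

/-- If `p` is a descendant of the node `(a, ρ)`, then every node whose key lies between `a` and
the key of `p` loses the rank comparison against `(a, ρ)`. -/
theorem isZipTree.rank_of_between {α : Type} [LinearOrder α] {t : ZTree α} (h : t.isZipTree)
    {a : α} {ρ : ℕ} {p q : α × ℕ} (ha : (a, ρ) ∈ t.nodes)
    (hp : p ∈ (t.subtreeAt a).nodes) (hq : q ∈ t.nodes) :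
    (a < q.1 → q.1 ≤ p.1 → q.2 ≤ ρ) ∧ (p.1 ≤ q.1 → q.1 < a → q.2 < ρ) := by
  induction t with
  | leaf => simp [nodes] at hq
  | node l k rk r ihl ihr =>
    obtain ⟨⟨hlk, hkr, hbl, hbr⟩, hheap⟩ := h
    have hheap' := hheap
    obtain ⟨-, -, hhl, hhr⟩ := hheap'
    simp only [subtreeAt] at hp
    simp only [nodes, List.mem_append, List.mem_cons] at ha hq
    split_ifs at hp with h1 h2
    · have hpl := hlk p ((subtreeAt_nodes_sublist a l).mem hp)
      have ha' : (a, ρ) ∈ l.nodes := by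
        rcases ha with ha | ha | ha
        · exact ha
        · simp only [Prod.mk.injEq] at ha
          exact absurd ha.1 h1.ne
        · exact absurd (hkr _ ha) h1.not_gt
      rcases hq with hq | rfl | hq
      · exact ihl ⟨hbl, hhl⟩ ha' hp hq
      · exact ⟨fun _ h => absurd hpl h.not_gt, fun _ h => absurd h h1.not_gt⟩
      · have := hkr _ hq
        exact ⟨fun _ h => absurd (this.trans_le h) hpl.not_gt,
          fun _ h => absurd (this.trans h) h1.not_gt⟩
    · have hpr := hkr p ((subtreeAt_nodes_sublist a r).mem hp)
      have ha' : (a, ρ) ∈ r.nodes := by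
        rcases ha with ha | ha | ha
        · exact absurd (hlk _ ha) h1
        · simp only [Prod.mk.injEq] at ha
          exact absurd ha.1 h2.ne'
        · exact ha
      rcases hq with hq | rfl | hq
      · have := hlk _ hq
        exact ⟨fun h _ => absurd (h.trans this) h1,
          fun h _ => absurd (hpr.trans_le h) this.not_gt⟩
      · exact ⟨fun h _ => absurd h h1, fun h _ => absurd hpr h.not_gt⟩
      · exact ihr ⟨hbr, hhr⟩ ha' hp hq
    · obtain rfl : a = k := le_antisymm (not_lt.1 h2) (not_lt.1 h1)
      obtain rfl : ρ = rk := by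
        rcases ha with ha | ha | ha
        · exact absurd (hlk _ ha) (lt_irrefl _)
        · exact (Prod.mk.inj ha).2
        · exact absurd (hkr _ ha) (lt_irrefl _)
      refine ⟨fun _ _ => hheap.rank_le_of_mem_nodes rfl (by simpa [nodes] using hq),
        fun _ hlt => ?_⟩
      rcases hq with hq | rfl | hq
      · exact hheap.rank_lt_of_mem_left hq
      · exact absurd hlt (lt_irrefl _)
      · exact absurd (hkr _ hq) hlt.not_gt

/-- The number of descendants of `i` is at most the number of keys `j` such that `i` wins the rank
comparison against every key between `i` and `j`. -/
theorem isZipTree.length_subtreeAt_le {n : ℕ} {f : Fin n → ℕ} {t : ZTree ℕ} (h : t.isZipTree)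
    (hperm : t.nodes.Perm ((List.finRange n).map fun j : Fin n => ((j : ℕ), f j))) (i : Fin n) :
    (t.subtreeAt (i : ℕ)).nodes.length ≤
      ((Finset.Ici i).filter fun j => ∀ q ∈ Finset.Ioc i j, f q < f i + 1).card +
      ((Finset.Iio i).filter fun j => ∀ q ∈ Finset.Ico j i, f q < f i + 0).card := by
  have hmem (j : Fin n) : ((j : ℕ), f j) ∈ t.nodes :=
    hperm.mem_iff.2 (List.mem_map.2 ⟨j, List.mem_finRange j, rfl⟩)
  have hnodup : ((t.subtreeAt (i : ℕ)).nodes.map Prod.fst).Nodup := by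
    refine List.Nodup.sublist ((subtreeAt_nodes_sublist _ t).map _) ?_
    rw [(hperm.map Prod.fst).nodup_iff, List.map_map]
    exact (List.nodup_finRange n).map Fin.val_injective
  rw [← List.length_map (f := Prod.fst), ← List.toFinset_card_of_nodup hnodup]
  refine le_trans ?_ (Finset.card_union_le _ _)
  refine le_trans (Finset.card_le_card ?_) (Finset.card_image_le (f := Fin.val))
  intro x hx
  obtain ⟨p, hp, rfl⟩ := List.mem_map.1 (List.mem_toFinset.1 hx)
  obtain ⟨j, -, rfl⟩ :=
    List.mem_map.1 (hperm.mem_iff.1 ((subtreeAt_nodes_sublist _ t).mem hp))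
  have key (q : Fin n) := h.rank_of_between (hmem i) hp (hmem q)
  refine Finset.mem_image.2 ⟨j, ?_, rfl⟩
  rcases le_or_gt i j with hij | hij
  · refine Finset.mem_union_left _ (Finset.mem_filter.2 ⟨Finset.mem_Ici.2 hij, fun q hq => ?_⟩)
    obtain ⟨h1, h2⟩ := Finset.mem_Ioc.1 hq
    exact Nat.lt_succ_of_le ((key q).1 h1 h2)
  · refine Finset.mem_union_right _ (Finset.mem_filter.2 ⟨Finset.mem_Iio.2 hij, fun q hq => ?_⟩)
    obtain ⟨h1, h2⟩ := Finset.mem_Ico.1 hq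
    exact (key q).2 h1 h2

end ZTree

theorem ENNReal.tsum_pi_prod_eq_prod_tsum {β : Type} {n : ℕ} (h : Fin n → β → ℝ≥0∞) :
    ∑' f : Fin n → β, ∏ q, h q (f q) = ∏ q, ∑' x, h q x := by
  induction n with
  | zero => simp
  | succ n ih =>
    rw [← (Fin.consEquiv fun _ => β).tsum_eq, ENNReal.tsum_prod', Fin.prod_univ_succ,
      ← ENNReal.tsum_mul_right]
    refine tsum_congr fun x => ?_
    rw [← ih, ← ENNReal.tsum_mul_left]
    simp [Fin.prod_univ_succ, Fin.consEquiv]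

/-- The probability that a geometric random variable with mean `1` is less than `k`. -/
noncomputable def geomCDF (k : ℕ) : ℝ≥0∞ := ∑ x ∈ Finset.range k, (1 / 2 : ℝ≥0∞) ^ (x + 1)

theorem geomCDF_add (k : ℕ) : geomCDF k + (1 / 2 : ℝ≥0∞) ^ k = 1 := by
  induction k with
  | zero => simp [geomCDF]
  | succ k ih =>
    rw [geomCDF, Finset.sum_range_succ, ← geomCDF, add_assoc, pow_succ, ← mul_add,
      ENNReal.add_halves, mul_one, ih]

theorem geomCDF_le_one (k : ℕ) : geomCDF k ≤ 1 := by
  rw [← geomCDF_add k]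
  exact le_self_add

theorem tsum_half_pow_succ : ∑' x : ℕ, (1 / 2 : ℝ≥0∞) ^ (x + 1) = 1 := by
  rw [ENNReal.tsum_geometric_add_one, one_div, ENNReal.one_sub_inv_two, inv_inv,
    ENNReal.inv_mul_cancel two_ne_zero ENNReal.ofNat_ne_top]

theorem tsum_prod_geom_mul_indicator {n : ℕ} (i : Fin n) (S : Finset (Fin n)) (hi : i ∉ S)
    (e : ℕ) :
    ∑' f : Fin n → ℕ, (∏ j, (1 / 2 : ℝ≥0∞) ^ (f j + 1)) *
        (if ∀ q ∈ S, f q < f i + e then 1 else 0) =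
      ∑' m : ℕ, (1 / 2 : ℝ≥0∞) ^ (m + 1) * geomCDF (m + e) ^ S.card := by
  classical
  let h (m : ℕ) (q : Fin n) (x : ℕ) : ℝ≥0∞ :=
    if q = i then (if x = m then (1 / 2 : ℝ≥0∞) ^ (x + 1) else 0)
    else if q ∈ S then (if x < m + e then (1 / 2 : ℝ≥0∞) ^ (x + 1) else 0)
    else (1 / 2 : ℝ≥0∞) ^ (x + 1)
  have hfiber (f : Fin n → ℕ) : (∏ j, (1 / 2 : ℝ≥0∞) ^ (f j + 1)) *
        (if ∀ q ∈ S, f q < f i + e then 1 else 0) = ∑' m, ∏ q, h m q (f q) := by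
    rw [tsum_eq_single (f i)]
    · split_ifs with hS
      · rw [mul_one]
        refine Finset.prod_congr rfl fun q _ => ?_
        by_cases hqi : q = i
        · simp [h, hqi]
        · by_cases hqS : q ∈ S
          · simp [h, hqi, hqS, hS q hqS]
          · simp [h, hqi, hqS]
      · push Not at hS
        obtain ⟨q, hqS, hq⟩ := hS
        rw [mul_zero, Finset.prod_eq_zero (Finset.mem_univ q)]
        have hqi : q ≠ i := fun hqi => hi (hqi ▸ hqS)
        simp [h, hqi, hqS, hq.not_gt]
    · intro m hm
      refine Finset.prod_eq_zero (Finset.mem_univ i) ?_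
      simp [h, hm.symm]
  have hfactor (m : ℕ) (q : Fin n) : ∑' x, h m q x =
      (if q = i then (1 / 2 : ℝ≥0∞) ^ (m + 1) else 1) *
        (if q ∈ S then geomCDF (m + e) else 1) := by
    by_cases hqi : q = i
    · simp only [h, hqi, if_true, hi, if_false, mul_one]
      rw [tsum_eq_single m (fun x hx => if_neg hx), if_pos rfl]
    · by_cases hqS : q ∈ S
      · simp only [h, hqi, if_false, hqS, if_true, one_mul]
        rw [tsum_eq_sum (s := Finset.range (m + e))
          (fun x hx => if_neg (by simpa using hx)), geomCDF]
        exact Finset.sum_congr rfl fun x hx => if_pos (Finset.mem_range.1 hx)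
      · simp only [h, hqi, if_false, hqS, one_mul]
        exact tsum_half_pow_succ
  simp_rw [hfiber]
  rw [ENNReal.tsum_comm]
  refine tsum_congr fun m => ?_
  rw [ENNReal.tsum_pi_prod_eq_prod_tsum]
  simp_rw [hfactor, Finset.prod_mul_distrib]
  simp [Finset.prod_ite_mem]

/-- The partial geometric sum `∑ d < K, q (1 - q) ^ d` is at most `min 1 (K q)`. -/
theorem mul_geom_sum_le_min {a q : ℝ≥0∞} (h : a + q = 1) (K : ℕ) :
    ∑ d ∈ Finset.range K, q * a ^ d ≤ min 1 (K * q) := by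
  have ha : a ≤ 1 := h ▸ le_self_add
  refine le_min ?_ ?_
  · have : ∑ d ∈ Finset.range K, q * a ^ d + a ^ K = 1 := by
      induction K with
      | zero => simp
      | succ K ih =>
        rw [Finset.sum_range_succ, add_assoc, pow_succ, mul_comm q, ← mul_add, add_comm q, h,
          mul_one, ih]
    rw [← this]
    exact le_self_add
  · calc ∑ d ∈ Finset.range K, q * a ^ d ≤ ∑ _d ∈ Finset.range K, q :=
          Finset.sum_le_sum fun d _ => mul_le_of_le_one_right' (pow_le_one' ha d)
      _ = K * q := by simp

theorem tsum_min_one_mul_half_pow_le (n : ℕ) :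
    ∑' m : ℕ, min 1 ((n : ℝ≥0∞) * (1 / 2) ^ (m + 1)) ≤ Nat.log 2 n + 2 := by
  set c := Nat.log 2 n
  rw [← Summable.sum_add_tsum_nat_add' (k := c) ENNReal.summable]
  refine add_le_add ?_ ?_
  · calc ∑ m ∈ Finset.range c, min 1 ((n : ℝ≥0∞) * (1 / 2) ^ (m + 1))
        ≤ ∑ _m ∈ Finset.range c, 1 := Finset.sum_le_sum fun _ _ => min_le_left _ _
      _ = c := by simp
  · have hn : (n : ℝ≥0∞) ≤ 2 ^ (c + 1) := by
      exact_mod_cast (Nat.lt_pow_succ_log_self one_lt_two n).le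
    have hhalf : (2 : ℝ≥0∞) ^ c * (1 / 2) ^ c = 1 := by
      rw [← mul_pow, one_div, ENNReal.mul_inv_cancel two_ne_zero ENNReal.ofNat_ne_top, one_pow]
    calc ∑' m : ℕ, min 1 ((n : ℝ≥0∞) * (1 / 2) ^ (m + c + 1))
        ≤ ∑' m : ℕ, 2 ^ (c + 1) * (1 / 2 : ℝ≥0∞) ^ c * (1 / 2) ^ (m + 1) := by
          refine ENNReal.tsum_le_tsum fun m => (min_le_right _ _).trans ?_
          rw [mul_assoc, ← pow_add]
          gcongr ?_ * ?_
          exact le_of_eq (by ring)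
      _ = 2 := by
          rw [ENNReal.tsum_mul_left, tsum_half_pow_succ, pow_succ, mul_one, mul_right_comm, hhalf,
            one_mul]

theorem Finset.sum_comp_le_sum_range {ι : Type} (s : Finset ι) (g : ι → ℕ) {n : ℕ}
    (hg : ∀ j ∈ s, g j < n) (hinj : Set.InjOn g s) (F : ℕ → ℝ≥0∞) :
    ∑ j ∈ s, F (g j) ≤ ∑ d ∈ Finset.range n, F d := by
  rw [← Finset.sum_image hinj]
  refine Finset.sum_le_sum_of_subset fun d hd => ?_
  obtain ⟨j, hj, rfl⟩ := Finset.mem_image.1 hd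
  exact Finset.mem_range.2 (hg j hj)

theorem sum_tsum_right_le {n : ℕ} (i : Fin n) :
    ∑ j ∈ Finset.Ici i, ∑' m : ℕ,
        (1 / 2 : ℝ≥0∞) ^ (m + 1) * geomCDF (m + 1) ^ (Finset.Ioc i j).card ≤
      Nat.log 2 n + 2 := by
  calc _ ≤ ∑ d ∈ Finset.range n, ∑' m : ℕ, (1 / 2 : ℝ≥0∞) ^ (m + 1) * geomCDF (m + 1) ^ d := by
        have hle := (Finset.Ici i).sum_comp_le_sum_range (n := n)
          (fun j => (Finset.Ioc i j).card) ?_ ?_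
          (fun d => ∑' m : ℕ, (1 / 2 : ℝ≥0∞) ^ (m + 1) * geomCDF (m + 1) ^ d)
        · exact hle
        · intro j _
          rw [Fin.card_Ioc]
          omega
        · intro j hj k hk hjk
          simp only [Finset.coe_Ici, Set.mem_Ici, Fin.le_def, Fin.card_Ioc] at hj hk hjk
          omega
    _ = ∑' m : ℕ, ∑ d ∈ Finset.range n, (1 / 2 : ℝ≥0∞) ^ (m + 1) * geomCDF (m + 1) ^ d :=
        (Summable.tsum_finsetSum fun _ _ => ENNReal.summable).symm
    _ ≤ _ := (ENNReal.tsum_le_tsum fun m => mul_geom_sum_le_min (geomCDF_add (m + 1)) n).trans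
        (tsum_min_one_mul_half_pow_le n)

theorem sum_tsum_left_le {n : ℕ} (i : Fin n) :
    ∑ j ∈ Finset.Iio i, ∑' m : ℕ,
        (1 / 2 : ℝ≥0∞) ^ (m + 1) * geomCDF (m + 0) ^ (Finset.Ico j i).card ≤
      1 / 2 * (Nat.log 2 n + 2) := by
  have hshift (d : ℕ) : ∑' m : ℕ, (1 / 2 : ℝ≥0∞) ^ (m + 1) * geomCDF (m + 0) ^ (d + 1) ≤
      1 / 2 * ∑' m : ℕ, (1 / 2 : ℝ≥0∞) ^ (m + 1) * geomCDF (m + 1) ^ d := by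
    rw [tsum_eq_zero_add' ENNReal.summable, ← ENNReal.tsum_mul_left]
    simp only [add_zero]
    rw [show geomCDF 0 = 0 by simp [geomCDF], zero_pow d.succ_ne_zero, mul_zero, zero_add]
    refine ENNReal.tsum_le_tsum fun m => ?_
    rw [pow_succ' _ (m + 1), mul_assoc]
    gcongr _ * (_ * ?_)
    rw [pow_succ]
    exact mul_le_of_le_one_right' (geomCDF_le_one _)
  have hcard {j : Fin n} (hj : j ∈ Finset.Iio i) :
      (Finset.Ico j i).card = (i - j - 1 : ℕ) + 1 := by
    have := Fin.lt_def.1 (Finset.mem_Iio.1 hj)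
    rw [Fin.card_Ico]
    omega
  calc _ ≤ ∑ j ∈ Finset.Iio i, 1 / 2 *
          ∑' m : ℕ, (1 / 2 : ℝ≥0∞) ^ (m + 1) * geomCDF (m + 1) ^ (i - j - 1 : ℕ) := by
        refine Finset.sum_le_sum fun j hj => ?_
        rw [hcard hj]
        exact hshift _
    _ ≤ ∑ d ∈ Finset.range n, 1 / 2 *
          ∑' m : ℕ, (1 / 2 : ℝ≥0∞) ^ (m + 1) * geomCDF (m + 1) ^ d := by
        have hle := (Finset.Iio i).sum_comp_le_sum_range (n := n)
          (fun j => (i - j - 1 : ℕ)) (fun j _ => by omega) ?_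
          (fun d => 1 / 2 * ∑' m : ℕ, (1 / 2 : ℝ≥0∞) ^ (m + 1) * geomCDF (m + 1) ^ d)
        · exact hle
        · intro j hj k hk hjk
          simp only [Finset.coe_Iio, Set.mem_Iio, Fin.lt_def] at hj hk hjk
          omega
    _ = 1 / 2 *
          ∑' m : ℕ, ∑ d ∈ Finset.range n, (1 / 2 : ℝ≥0∞) ^ (m + 1) * geomCDF (m + 1) ^ d := by
        rw [← Finset.mul_sum, Summable.tsum_finsetSum fun _ _ => ENNReal.summable]
    _ ≤ _ := by
        gcongr
        exact (ENNReal.tsum_le_tsum fun m => mul_geom_sum_le_min (geomCDF_add (m + 1)) n).trans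
          (tsum_min_one_mul_half_pow_le n)

theorem tsum_prod_geom_mul_card_filter {n : ℕ} (i : Fin n) (J : Finset (Fin n))
    (S : Fin n → Finset (Fin n)) (hi : ∀ j, i ∉ S j) (e : ℕ) :
    ∑' f : Fin n → ℕ, (∏ j, (1 / 2 : ℝ≥0∞) ^ (f j + 1)) *
        (((J.filter fun j => ∀ q ∈ S j, f q < f i + e).card : ℕ) : ℝ≥0∞) =
      ∑ j ∈ J, ∑' m : ℕ, (1 / 2 : ℝ≥0∞) ^ (m + 1) * geomCDF (m + e) ^ (S j).card := by
  simp_rw [Finset.card_filter, Nat.cast_sum, Nat.cast_ite, Nat.cast_one, Nat.cast_zero,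
    Finset.mul_sum]
  rw [Summable.tsum_finsetSum fun _ _ => ENNReal.summable]
  exact Finset.sum_congr rfl fun j _ => tsum_prod_geom_mul_indicator i (S j) (hi j) e

/-- **Expected number of descendants of an arbitrary node (Theorem 5, second part).**
Let `n ≥ 2`, let `r : Fin n → ℕ` be independent geometric random variables with
`P(r j = m) = 1/2^(m+1)` (modelled by the product PMF `μ`), and let `T r` be the
(unique) zip tree on nodes with keys `0, …, n−1` and ranks `r`. Then for every index
`i`, the expected number of descendants of node `i` (the nodes of the subtree rooted
at `i`, including `i` itself) is at most `(3/2)·lg n + 3`. -/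
theorem expected_descendants (n : ℕ) (hn : 2 ≤ n)
    (μ : PMF (Fin n → ℕ))
    (hμ : ∀ f : Fin n → ℕ, μ f = ∏ j : Fin n, (1 / 2 : ℝ≥0∞) ^ (f j + 1))
    (T : (Fin n → ℕ) → ZTree ℕ)
    (hT : ∀ f : Fin n → ℕ, (T f).isZipTree ∧
        (T f).nodes.Perm ((List.finRange n).map fun j : Fin n => ((j : ℕ), f j)))
    (i : Fin n) :
    ∑' f : Fin n → ℕ,
        μ f * ((((T f).subtreeAt (i : ℕ)).nodes.length : ℕ) : ℝ≥0∞) ≤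
      ENNReal.ofReal ((3 / 2) * Real.logb 2 n + 3) := by
  calc ∑' f : Fin n → ℕ, μ f * ((((T f).subtreeAt (i : ℕ)).nodes.length : ℕ) : ℝ≥0∞)
      ≤ ∑' f : Fin n → ℕ, ((∏ j, (1 / 2 : ℝ≥0∞) ^ (f j + 1)) *
          (((Finset.Ici i).filter fun j => ∀ q ∈ Finset.Ioc i j, f q < f i + 1).card : ℝ≥0∞) +
          (∏ j, (1 / 2 : ℝ≥0∞) ^ (f j + 1)) *
          (((Finset.Iio i).filter fun j => ∀ q ∈ Finset.Ico j i, f q < f i + 0).card : ℝ≥0∞)) := by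
        refine ENNReal.tsum_le_tsum fun f => ?_
        rw [hμ, ← mul_add]
        gcongr
        exact_mod_cast (hT f).1.length_subtreeAt_le (hT f).2 i
    _ ≤ (Nat.log 2 n + 2) + 1 / 2 * (Nat.log 2 n + 2) := by
        rw [ENNReal.tsum_add, tsum_prod_geom_mul_card_filter _ _ _ (by simp),
          tsum_prod_geom_mul_card_filter _ _ _ (by simp)]
        exact add_le_add (sum_tsum_right_le i) (sum_tsum_left_le i)
    _ = ENNReal.ofReal ((3 / 2) * Nat.log 2 n + 3) := by
        rw [show (3 / 2 : ℝ) * Nat.log 2 n + 3 =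
            (Nat.log 2 n + 2) + 1 / 2 * (Nat.log 2 n + 2) by ring,
          ENNReal.ofReal_add (by positivity) (by positivity),
          ENNReal.ofReal_mul (by positivity), ENNReal.ofReal_add (by positivity) (by positivity),
          ENNReal.ofReal_div_of_pos two_pos]
        simp
    _ ≤ _ := by
        refine ENNReal.ofReal_le_ofReal ?_
        gcongr
        exact_mod_cast Real.natLog_le_logb n 2
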